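/- Let P and Q be posets on the disjoint ground sets {1,...,n1} and {n1+1,...,n1+n2} respectively, let n = n1 + n2, and let P + Q be their parallel composition. Then QH(P + Q) = (n1/n) · QH(P) + (n2/n) · QH(Q). -/

import Mathlib

open MeasureTheory Finset

attribute [local instance] Classical.propDecidable

noncomputable def harm (q : ℕ) : ℝ := ∑ m ∈ Finset.range q, (1 : ℝ) / (m + 1)

noncomputable def linExts (α : Type) [Fintype α] (r : α → α → Prop) :
    Finset (α ≃ Fin (Fintype.card α)) :=
  Finset.univ.filter fun σ => ∀ i j : α, r i j → σ i ≤ σ j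

noncomputable def dN {α : Type} [Fintype α] (r : α → α → Prop)
    (σ : α ≃ Fin (Fintype.card α)) (i : α) : ℕ :=
  if ∀ j : α, r j i → j = i then (σ i : ℕ) + 1
  else sInf {m : ℕ | ∃ j : α, j ≠ i ∧ r j i ∧ m = (σ i : ℕ) - (σ j : ℕ)}

noncomputable def QLB (α : Type) [Fintype α] (r : α → α → Prop) : ℝ :=
  (∑ σ ∈ linExts α r, ∑ i : α, harm (dN r σ i - 1)) / ((linExts α r).card : ℝ)

def chainPolytope (α : Type) [Fintype α] (r : α → α → Prop) : Set (α → ℝ) :=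
  {y | (∀ i, 0 ≤ y i) ∧
    ∀ C : Finset α, (∀ i ∈ C, ∀ j ∈ C, r i j ∨ r j i) → ∑ i ∈ C, y i ≤ 1}

def orderPolytope (α : Type) [Fintype α] (r : α → α → Prop) : Set (α → ℝ) :=
  {y | (∀ i, 0 ≤ y i ∧ y i ≤ 1) ∧ ∀ i j : α, r i j → y i ≤ y j}

noncomputable def transferMap (α : Type) [Fintype α] (r : α → α → Prop)
    (y : α → ℝ) (i : α) : ℝ :=
  if ∀ j : α, r j i → j = i then y i
  else sInf {t : ℝ | ∃ j : α, j ≠ i ∧ r j i ∧ t = y i - y j}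

noncomputable def QH (α : Type) [Fintype α] (r : α → α → Prop) : ℝ :=
  ⨍ z in chainPolytope α r, -(1 / (Fintype.card α : ℝ)) * ∑ i : α, Real.log (z i)

noncomputable def posetEntropy (α : Type) [Fintype α] (r : α → α → Prop) : ℝ :=
  sInf {x : ℝ | ∃ z ∈ chainPolytope α r, (∀ i, 0 < z i) ∧
    x = -(1 / (Fintype.card α : ℝ)) * ∑ i : α, Real.log (z i)}

def seriesComp {α β : Type} (r : α → α → Prop) (s : β → β → Prop) :
    α ⊕ β → α ⊕ β → Prop
  | Sum.inl x, Sum.inl y => r x y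
  | Sum.inr x, Sum.inr y => s x y
  | Sum.inl _, Sum.inr _ => True
  | Sum.inr _, Sum.inl _ => False

def parallelComp {α β : Type} (r : α → α → Prop) (s : β → β → Prop) :
    α ⊕ β → α ⊕ β → Prop
  | Sum.inl x, Sum.inl y => r x y
  | Sum.inr x, Sum.inr y => s x y
  | _, _ => False

theorem isClosed_chainPolytope (α : Type) [Fintype α] (r : α → α → Prop) :
    IsClosed (chainPolytope α r) := by
  simp only [chainPolytope, Set.ofPred_and, Set.ofPred_forall]
  refine (isClosed_iInter fun i => isClosed_le (by fun_prop) (by fun_prop)).inter ?_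
  exact isClosed_iInter fun C => isClosed_iInter fun _ => isClosed_le (by fun_prop) (by fun_prop)

theorem chainPolytope_subset_cube {α : Type} [Fintype α] {r : α → α → Prop} (hr : ∀ a, r a a) :
    chainPolytope α r ⊆ Set.univ.pi fun _ => Set.Icc (0 : ℝ) 1 := by
  intro y hy i _
  refine ⟨hy.1 i, ?_⟩
  simpa using hy.2 {i} (by simp [hr i])

theorem volume_chainPolytope_ne_top {α : Type} [Fintype α] {r : α → α → Prop}
    (hr : ∀ a, r a a) : volume (chainPolytope α r) ≠ ⊤ := by
  refine ne_top_of_le_ne_top ?_ (measure_mono (chainPolytope_subset_cube hr))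
  rw [volume_pi_pi]
  simp

theorem volume_chainPolytope_ne_zero (α : Type) [Fintype α] (r : α → α → Prop) :
    volume (chainPolytope α r) ≠ 0 := by
  have hsub : (Set.univ.pi fun _ : α => Set.Icc (0 : ℝ) (1 / (Fintype.card α + 1))) ⊆
      chainPolytope α r := by
    intro y hy
    refine ⟨fun i => (hy i trivial).1, fun C _ => ?_⟩
    calc ∑ i ∈ C, y i ≤ ∑ _i ∈ C, (1 / (Fintype.card α + 1) : ℝ) :=
          Finset.sum_le_sum fun i _ => (hy i trivial).2
      _ = (C.card : ℝ) / (Fintype.card α + 1) := by simp [div_eq_mul_inv]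
      _ ≤ 1 := by
        rw [div_le_one (by positivity)]
        exact_mod_cast (Finset.card_le_univ C).trans (Nat.le_succ _)
  refine fun h => absurd (measure_mono_null hsub h) ?_
  rw [volume_pi_pi, ← ne_eq, Finset.prod_ne_zero_iff]
  intro i _
  rw [Real.volume_Icc, sub_zero, ne_eq, ENNReal.ofReal_eq_zero, not_le]
  positivity

theorem integrableOn_log_chainPolytope {α : Type} [Fintype α] {r : α → α → Prop}
    (hr : ∀ a, r a a) (i : α) :
    IntegrableOn (fun z : α → ℝ => Real.log (z i)) (chainPolytope α r) := by
  refine IntegrableOn.mono_set ?_ (chainPolytope_subset_cube hr)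
  have : IsProbabilityMeasure ((volume : Measure ℝ).restrict (Set.Icc 0 1)) := ⟨by simp⟩
  have hlog : Integrable Real.log ((volume : Measure ℝ).restrict (Set.Icc 0 1)) :=
    (intervalIntegrable_iff_integrableOn_Icc_of_le zero_le_one).1
      intervalIntegral.intervalIntegrable_log'
  rw [IntegrableOn, volume_pi, Measure.restrict_pi_pi]
  exact (measurePreserving_eval (fun _ : α => (volume : Measure ℝ).restrict (Set.Icc 0 1))
    i).integrable_comp_of_integrable hlog

theorem preimage_chainPolytope_parallelComp {α β : Type} [Fintype α] [Fintype β]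
    (r : α → α → Prop) (s : β → β → Prop) :
    (MeasurableEquiv.sumPiEquivProdPi fun _ : α ⊕ β => ℝ) ⁻¹'
      (chainPolytope α r ×ˢ chainPolytope β s) = chainPolytope (α ⊕ β) (parallelComp r s) := by
  ext y
  constructor
  · rintro ⟨⟨hα, hα'⟩, ⟨hβ, hβ'⟩⟩
    refine ⟨fun i => i.rec hα hβ, fun C hC => ?_⟩
    have hL := hα' C.toLeft fun i hi j hj => by
      simpa [parallelComp] using hC (.inl i) (by simpa using hi) (.inl j) (by simpa using hj)
    have hR := hβ' C.toRight fun i hi j hj => by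
      simpa [parallelComp] using hC (.inr i) (by simpa using hi) (.inr j) (by simpa using hj)
    change ∑ i ∈ C.toLeft, y (.inl i) ≤ 1 at hL
    change ∑ i ∈ C.toRight, y (.inr i) ≤ 1 at hR
    rw [← C.toLeft_disjSum_toRight, Finset.sum_disjSum]
    rcases C.toLeft.eq_empty_or_nonempty with h | ⟨a, ha⟩
    · simpa [h] using hR
    rcases C.toRight.eq_empty_or_nonempty with h | ⟨b, hb⟩
    · simpa [h] using hL
    · simpa [parallelComp] using
        hC (.inl a) (by simpa using ha) (.inr b) (by simpa using hb)
  · rintro ⟨h0, hC⟩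
    refine ⟨⟨fun i => h0 (.inl i), fun C h => ?_⟩, ⟨fun i => h0 (.inr i), fun C h => ?_⟩⟩
    · have := hC (C.disjSum ∅) (by simpa [parallelComp] using h)
      rwa [Finset.sum_disjSum, Finset.sum_empty, add_zero] at this
    · have := hC (Finset.disjSum ∅ C) (by simpa [parallelComp] using h)
      rwa [Finset.sum_disjSum, Finset.sum_empty, zero_add] at this

theorem setAverage_prod_add {X Y : Type*} [MeasurableSpace X] [MeasurableSpace Y]
    {μ : Measure X} {ν : Measure Y} [SFinite μ] [SFinite ν] {A : Set X} {B : Set Y}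
    {f : X → ℝ} {g : Y → ℝ} (hA : μ A ≠ 0) (hA' : μ A ≠ ⊤) (hB : ν B ≠ 0) (hB' : ν B ≠ ⊤)
    (hf : IntegrableOn f A μ) (hg : IntegrableOn g B ν) :
    ⨍ z in A ×ˢ B, (f z.1 + g z.2) ∂(μ.prod ν) =
      (⨍ x in A, f x ∂μ) + ⨍ y in B, g y ∂ν := by
  have : IsFiniteMeasure (μ.restrict A) := isFiniteMeasure_restrict.2 hA'
  have : IsFiniteMeasure (ν.restrict B) := isFiniteMeasure_restrict.2 hB'
  have hA0 : μ.real A ≠ 0 := (measureReal_ne_zero_iff hA').2 hA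
  have hB0 : ν.real B ≠ 0 := (measureReal_ne_zero_iff hB').2 hB
  rw [setAverage_eq, setAverage_eq, setAverage_eq, ← Measure.prod_restrict,
    integral_add (hf.comp_fst _) (hg.comp_snd _), integral_fun_fst, integral_fun_snd,
    measureReal_prod_prod]
  simp only [measureReal_restrict_apply_univ, smul_eq_mul]
  field_simp

theorem QH_eq_neg_average {α : Type} [Fintype α] (r : α → α → Prop) :
    QH α r = -(1 / (Fintype.card α : ℝ)) *
      ⨍ z in chainPolytope α r, ∑ i : α, Real.log (z i) := by
  rw [QH, average, average, integral_const_mul]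

theorem average_log_parallelComp {α β : Type} [Fintype α] [Fintype β]
    {r : α → α → Prop} {s : β → β → Prop} (hr : ∀ a, r a a) (hs : ∀ b, s b b) :
    ⨍ z in chainPolytope (α ⊕ β) (parallelComp r s), ∑ i, Real.log (z i) =
      (⨍ x in chainPolytope α r, ∑ i, Real.log (x i)) +
        ⨍ y in chainPolytope β s, ∑ j, Real.log (y j) := by
  rw [← setAverage_prod_add (volume_chainPolytope_ne_zero α r) (volume_chainPolytope_ne_top hr)
    (volume_chainPolytope_ne_zero β s) (volume_chainPolytope_ne_top hs)
    (integrable_finsetSum _ fun i _ => integrableOn_log_chainPolytope hr i)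
    (integrable_finsetSum _ fun j _ => integrableOn_log_chainPolytope hs j)]
  have he := volume_measurePreserving_sumPiEquivProdPi fun _ : α ⊕ β => ℝ
  rw [setAverage_eq, setAverage_eq, ← preimage_chainPolytope_parallelComp,
    ← Measure.volume_eq_prod, ← he.setIntegral_preimage_emb (MeasurableEquiv.measurableEmbedding _),
    measureReal_def, he.measure_preimage_equiv, measureReal_def]
  simp only [Fintype.sum_sum_type]
  rfl

/-- `QH(P + Q) = (n1/n) QH(P) + (n2/n) QH(Q)` for the parallel composition. -/
theorem stmt_7 (α β : Type) [Fintype α] [Fintype β]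
    (r : α → α → Prop) (s : β → β → Prop)
    [IsPartialOrder α r] [IsPartialOrder β s] :
    QH (α ⊕ β) (parallelComp r s) =
      ((Fintype.card α : ℝ) / ((Fintype.card α : ℝ) + (Fintype.card β : ℝ))) * QH α r +
      ((Fintype.card β : ℝ) / ((Fintype.card α : ℝ) + (Fintype.card β : ℝ))) * QH β s := by
  have hr : ∀ a, r a a := fun a => refl_of r a
  have hs : ∀ b, s b b := fun b => refl_of s b
  simp only [QH_eq_neg_average, average_log_parallelComp hr hs, Fintype.card_sum, Nat.cast_add]
  rcases isEmpty_or_nonempty α with hα | hα <;> rcases isEmpty_or_nonempty β with hβ | hβ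
  all_goals simp
  all_goals field_simp
  all_goals ring
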